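/- Let r ≥ 3 and m be integers with 2 ≤ m ≤ r−1, and let x, y, z, w be nonnegative integers. Then (r−1)·(x − y + z − w)² + x² + y² + z² + w² + (r−2)·x + (2m−r)·y + (r−2m)·z + r·w ≥ 0. -/

import Mathlib

theorem quadratic_sub_linear_nonneg {a b : ℤ} (h : |b| ≤ a) (d : ℤ) :
    0 ≤ a * d ^ 2 - b * d := by
  have hd : |d| ≤ d ^ 2 := Int.abs_eq_natAbs d ▸ Int.natAbs_le_self_sq d
  have ha : 0 ≤ a := (abs_nonneg b).trans h
  have hbd : b * d ≤ a * d ^ 2 :=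
    calc b * d ≤ |b * d| := le_abs_self _
      _ = |b| * |d| := abs_mul b d
      _ ≤ a * d ^ 2 := by gcongr
  linarith

theorem g_nonneg
    (r m : ℕ) (hr : 3 ≤ r) (hm1 : 2 ≤ m) (hm2 : m ≤ r - 1) (x y z w : ℕ) :
    0 ≤ ((r : ℤ) - 1) * ((x : ℤ) - y + z - w) ^ 2
        + (x : ℤ) ^ 2 + (y : ℤ) ^ 2 + (z : ℤ) ^ 2 + (w : ℤ) ^ 2
        + ((r : ℤ) - 2) * x + (2 * (m : ℤ) - r) * y
        + ((r : ℤ) - 2 * m) * z + (r : ℤ) * w := by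
  have hm1' : (2 : ℤ) ≤ m := by omega
  have hm2' : (m : ℤ) ≤ r - 1 := by omega
  have hx : 0 ≤ (2 * (m : ℤ) - 2) * x := mul_nonneg (by linarith) (by positivity)
  have hw : 0 ≤ (2 * (r : ℤ) - 2 * m) * w := mul_nonneg (by linarith) (by positivity)
  have hd := quadratic_sub_linear_nonneg (a := (r : ℤ) - 1) (b := 2 * (m : ℤ) - r)
    (abs_le.mpr ⟨by linarith, by linarith⟩) ((x : ℤ) - y + z - w)
  linarith [sq_nonneg (x : ℤ), sq_nonneg (y : ℤ), sq_nonneg (z : ℤ), sq_nonneg (w : ℤ)]
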